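/- arXiv:1001.1438 — 3 statements merged into one kernel-verified Lean document; each statement's English description precedes it below -/
import Mathlib

section
/- Consider Cournot oligopoly data. If conditions (2.15) hold, then the Nash equilibrium is unique: there is at most one q* ∈ S with q_i* = f_i(q*_{−i}) for all i = 1,…,n. -/
open scoped BigOperators

/-- Clamping to an interval `[0, Q]` is nonexpansive. -/
theorem abs_clamp_sub_clamp_le (Q x y : ℝ) :
    |min Q (max 0 x) - min Q (max 0 y)| ≤ |x - y| := by
  have h₁ := abs_min_sub_min_le_max Q (max 0 x) Q (max 0 y)
  have h₂ := abs_max_sub_max_le_max 0 x 0 y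
  simp only [sub_self, abs_zero, abs_nonneg, max_eq_right] at h₁ h₂
  exact h₁.trans h₂

/-- A nonnegative vector bounded by weighted sums of its other entries vanishes if all two-cycles
have gain below one: compare the largest entry with the largest of the others. -/
theorem eq_zero_of_le_mul_sum_erase {n : ℕ} (hn : 2 ≤ n) {R d : Fin n → ℝ}
    (hR : ∀ i, 0 ≤ R i) (hd : ∀ i, 0 ≤ d i)
    (hle : ∀ i, d i ≤ R i * ∑ j ∈ Finset.univ.erase i, d j)
    (hgain : ∀ i j, i ≠ j → R i * R j * ((n : ℝ) - 1) ^ 2 < 1) : d = 0 := by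
  have hn1 : (0 : ℝ) ≤ (n : ℝ) - 1 := by
    have : (2 : ℝ) ≤ n := by exact_mod_cast hn
    linarith
  have hcard (i : Fin n) : (Finset.univ.erase i).card = n - 1 := by simp
  have hbound (i : Fin n) (M : ℝ) (hM : ∀ j ∈ Finset.univ.erase i, d j ≤ M) :
      d i ≤ R i * (((n : ℝ) - 1) * M) := by
    refine (hle i).trans (mul_le_mul_of_nonneg_left ?_ (hR i))
    have h := Finset.sum_le_card_nsmul _ _ _ hM
    rwa [hcard, nsmul_eq_mul, Nat.cast_pred (by omega)] at h
  obtain ⟨i, -, hi⟩ := Finset.exists_max_image Finset.univ d ⟨⟨0, by omega⟩, Finset.mem_univ _⟩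
  obtain ⟨j, hj, hjmax⟩ := Finset.exists_max_image (Finset.univ.erase i) d
    (Finset.card_pos.mp (by rw [hcard]; omega))
  have hdi : d i ≤ R i * R j * ((n : ℝ) - 1) ^ 2 * d i := calc
    d i ≤ R i * (((n : ℝ) - 1) * d j) := hbound i _ hjmax
    _ ≤ R i * (((n : ℝ) - 1) * (R j * (((n : ℝ) - 1) * d i))) :=
      mul_le_mul_of_nonneg_left (mul_le_mul_of_nonneg_left
        (hbound j _ fun k _ => hi k (Finset.mem_univ k)) hn1) (hR i)
    _ = R i * R j * ((n : ℝ) - 1) ^ 2 * d i := by ring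
  have hi0 : d i ≤ 0 := by
    by_contra! hpos
    nlinarith [mul_lt_mul_of_pos_right (hgain i j (Finset.ne_of_mem_erase hj).symm) hpos]
  funext k
  exact le_antisymm ((hi k (Finset.mem_univ k)).trans hi0) (hd k)

/-- Corollary 2.3: under the small-gain conditions (2.15), the Nash equilibrium of the
Cournot oligopoly game is unique: there is at most one `q* ∈ S` with
`q*_i = f_i(q*_{-i})` for all `i`. -/
theorem cournot_nash_unique (n : ℕ) (hn : 2 ≤ n) (a b : ℝ) (ha : 0 < a) (hb : 0 < b)
    (Q c K : Fin n → ℝ) (hQ : ∀ i, 0 < Q i) (haQ : ∑ i, Q i ≤ a)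
    (hbK : ∀ i, 0 < 2 * b + K i)
    (R : Fin n → ℝ) (hR : ∀ i, R i = b / (2 * b + K i))
    (hSG : ∀ p : ℕ, 2 ≤ p → p ≤ n → ∀ ι : Fin p → Fin n, Function.Injective ι →
      (∏ j, R (ι j)) * ((n : ℝ) - 1) ^ p < 1) :
    ∀ q q' : Fin n → ℝ,
      (∀ i, q i ∈ Set.Icc 0 (Q i)) → (∀ i, q' i ∈ Set.Icc 0 (Q i)) →
      (∀ i, q i = min (Q i) (max 0 ((a * b - c i) / (2 * b + K i) -
        R i * ∑ j ∈ Finset.univ.erase i, q j))) →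
      (∀ i, q' i = min (Q i) (max 0 ((a * b - c i) / (2 * b + K i) -
        R i * ∑ j ∈ Finset.univ.erase i, q' j))) →
      q = q' := by
  intro q q' _ _ hq hq'
  have hR0 (i : Fin n) : 0 ≤ R i := by
    rw [hR]
    exact (div_pos hb (hbK i)).le
  have hdist : (fun i => |q i - q' i|) = 0 := by
    refine eq_zero_of_le_mul_sum_erase hn hR0 (fun i => abs_nonneg _) (fun i => ?_) ?_
    · conv_lhs => rw [hq i, hq' i]
      refine (abs_clamp_sub_clamp_le _ _ _).trans ?_
      rw [sub_sub_sub_cancel_left, ← mul_sub, ← Finset.sum_sub_distrib, abs_mul,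
        abs_of_nonneg (hR0 i)]
      exact mul_le_mul_of_nonneg_left ((Finset.abs_sum_le_sum_abs _ _).trans
        (Finset.sum_le_sum fun j _ => (abs_sub_comm _ _).le)) (hR0 i)
    · intro i j hij
      have hinj : Function.Injective ![i, j] := by
        intro x y hxy
        fin_cases x <;> fin_cases y <;> simp [hij, hij.symm] at hxy ⊢
      simpa using hSG 2 le_rfl hn ![i, j] hinj
  funext i
  exact sub_eq_zero.mp (abs_eq_zero.mp (congrFun hdist i))
end

section
/- Let S_i ⊆ ℝ^{k_i} (i = 1,…,n, n ≥ 2) be nonempty closed convex sets, S := S_1×…×S_n, and let f_i : Π_{j≠i} S_j → S_i be functions. Suppose there exists q* = (q_1*,…,q_n*) ∈ S with q_i* = f_i(q*_{−i}) for all i, and functions γ̃_{i,j} of class N (i ≠ j) such that |f_i(q_{−i}) − q_i*| ≤ max_{j≠i} γ̃_{i,j}(|q_j − q_j*|) for all q ∈ S and all i. If there exists ω > 1 such that the cyclic small-gain conditions (3.15) hold for γ_{i,j}(s) := ω·γ̃_{i,j}(ω s), then q* is the unique fixed point of the mapping F : S → S, F(q) := (f_1(q_{−1}),…,f_n(q_{−n})).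 -/
open scoped BigOperators

/-- Euclidean norm of a vector in ℝ^m. -/
noncomputable def eNorm {m : ℕ} (v : Fin m → ℝ) : ℝ := Real.sqrt (∑ i, (v i) ^ 2)

/-- Max over indices `j ≠ i` of a finite family of reals (as a supremum). -/
noncomputable def maxNe {n : ℕ} (i : Fin n) (g : Fin n → ℝ) : ℝ :=
  sSup {y | ∃ j, j ≠ i ∧ y = g j}

/-- A function `γ : [0,∞) → [0,∞)` of class N: continuous, non-decreasing, `γ(0)=0`. -/
def ClassN (γ : ℝ → ℝ) : Prop :=
  ContinuousOn γ (Set.Ici 0) ∧ MonotoneOn γ (Set.Ici 0) ∧ γ 0 = 0 ∧ ∀ s, 0 ≤ s → 0 ≤ γ s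

/-- The cyclic composition `γ_{ι 0, ι 1} ∘ γ_{ι 1, ι 2} ∘ ⋯ ∘ γ_{ι (p-1), ι 0}`. -/
noncomputable def cyclicComp {n p : ℕ} (γ : Fin n → Fin n → ℝ → ℝ) (ι : Fin p → Fin n) :
    ℝ → ℝ :=
  (List.ofFn (fun j : Fin p =>
    γ (ι j) (ι ⟨(j.1 + 1) % p, Nat.mod_lt _ j.pos⟩))).foldr (· ∘ ·) id

theorem eNorm_nonneg {m : ℕ} (v : Fin m → ℝ) : 0 ≤ eNorm v := Real.sqrt_nonneg _

theorem eq_zero_of_eNorm_eq_zero {m : ℕ} {v : Fin m → ℝ} (h : eNorm v = 0) : v = 0 := by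
  have hnn : 0 ≤ ∑ i, v i ^ 2 := Finset.sum_nonneg fun i _ => sq_nonneg (v i)
  have h0 := (Real.sqrt_eq_zero hnn).mp h
  funext i
  exact pow_eq_zero_iff two_ne_zero |>.mp
    ((Finset.sum_eq_zero_iff_of_nonneg fun i _ => sq_nonneg (v i)).mp h0 i (Finset.mem_univ i))

/-- The supremum defining `maxNe` is attained. -/
theorem exists_ne_maxNe_eq {n : ℕ} (hn : 2 ≤ n) (i : Fin n) (g : Fin n → ℝ) :
    ∃ j, j ≠ i ∧ maxNe i g = g j := by
  have : Nontrivial (Fin n) := Fin.nontrivial_iff_two_le.mpr hn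
  obtain ⟨j, hj⟩ := exists_ne i
  have hfin : {y | ∃ j, j ≠ i ∧ y = g j}.Finite :=
    (Set.finite_range g).subset fun y ⟨j, _, hy⟩ => ⟨j, hy.symm⟩
  have hne : {y | ∃ j, j ≠ i ∧ y = g j}.Nonempty := ⟨g j, j, hj, rfl⟩
  exact hne.csSup_mem hfin

theorem le_foldr_comp_ofFn {p : ℕ} (g : Fin p → ℝ → ℝ) (b : ℕ → ℝ)
    (h : ∀ j : Fin p, ∀ t, b (j + 1) ≤ t → b j ≤ g j t) (t : ℝ) (ht : b p ≤ t) :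
    b 0 ≤ (List.ofFn g).foldr (· ∘ ·) id t := by
  induction p generalizing b with
  | zero => simpa using ht
  | succ p ih =>
    rw [List.ofFn_succ, List.foldr_cons]
    refine h 0 _ ?_
    exact ih (fun j => g j.succ) (fun j => b (j + 1)) (fun j => h j.succ) ht

/-- A self-map of a finite type has a periodic point on every forward orbit. -/
theorem exists_iterate_mem_periodicPts {α : Type*} [Finite α] (σ : α → α) (x : α) :
    ∃ m, σ^[m] x ∈ Function.periodicPts σ := by
  obtain ⟨a, b, hab, heq⟩ := Finite.exists_ne_map_eq_of_infinite fun m : ℕ => σ^[m] x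
  wlog hlt : a < b generalizing a b
  · exact this b a hab.symm heq.symm (by omega)
  refine ⟨a, b - a, by omega, ?_⟩
  rw [Function.IsPeriodicPt, Function.IsFixedPt, ← Function.iterate_add_apply,
    Nat.sub_add_cancel hlt.le]
  exact heq.symm

/-- Under the cyclic small-gain conditions, a nonnegative family dominated by its own gains along
a successor map vanishes. -/
theorem eq_zero_of_le_gain {n : ℕ} (γ : Fin n → Fin n → ℝ → ℝ)
    (hSG : ∀ p : ℕ, 2 ≤ p → p ≤ n → ∀ ι : Fin p → Fin n, Function.Injective ι →
      ∀ s : ℝ, 0 < s → cyclicComp γ ι s < s)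
    (a : Fin n → ℝ) (ha : ∀ i, 0 ≤ a i) (σ : Fin n → Fin n) (hσ : ∀ i, σ i ≠ i)
    (hzero : ∀ i, a (σ i) = 0 → a i = 0)
    (hle : ∀ i t, a (σ i) ≤ t → a i ≤ γ i (σ i) t) (i : Fin n) : a i = 0 := by
  by_contra hi
  obtain ⟨m, hm⟩ := exists_iterate_mem_periodicPts σ i
  have hpos : ∀ m, a (σ^[m] i) ≠ 0 := by
    intro m
    induction m with
    | zero => exact hi
    | succ m ih =>
      rw [Function.iterate_succ_apply']
      exact fun h => ih (hzero _ h)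
  set x := σ^[m] i
  set p := Function.minimalPeriod σ x
  have hp0 : 0 < p := Function.minimalPeriod_pos_of_mem_periodicPts hm
  have hp1 : p ≠ 1 := fun h => hσ x (Function.minimalPeriod_eq_one_iff_isFixedPt.mp h)
  have hper : Function.IsPeriodicPt σ p x := Function.isPeriodicPt_minimalPeriod σ x
  let ι : Fin p → Fin n := fun j => σ^[j] x
  have hinj : Function.Injective ι := fun j l h =>
    Fin.ext (Function.iterate_injOn_Iio_minimalPeriod j.2 l.2 h)
  have hpn : p ≤ n := by simpa using Fintype.card_le_of_injective ι hinj
  refine (hSG p (by omega) hpn ι hinj (a x) ((ha x).lt_of_ne' (hpos m))).not_ge ?_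
  refine le_foldr_comp_ofFn _ (fun j => a (σ^[j] x)) (fun j t ht => ?_) (a x) ?_
  · have hnext : ι ⟨(j.1 + 1) % p, Nat.mod_lt _ j.pos⟩ = σ (σ^[j] x) := by
      simp only [ι]
      rw [hper.iterate_mod_apply, Function.iterate_succ_apply']
    rw [hnext]
    rw [Function.iterate_succ_apply'] at ht
    exact hle _ t ht
  · exact (congrArg a hper.eq).le

/-- Corollary 3.2/3.3: under the cyclic small-gain conditions (3.15), `q*` is the unique
fixed point of the best-reply map `F(q) = (f_1(q_{-1}),…,f_n(q_{-n}))` on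
`S = S_1 × ⋯ × S_n`. Here each `f i` is a function of the full profile which does not
depend on its own `i`-th component (encoding `f_i : Π_{j≠i} S_j → S_i`). -/
theorem smallgain_fixed_point_unique (n : ℕ) (hn : 2 ≤ n) (k : Fin n → ℕ)
    (Sset : (i : Fin n) → Set (Fin (k i) → ℝ))
    (hSne : ∀ i, (Sset i).Nonempty) (hScl : ∀ i, IsClosed (Sset i))
    (hScv : ∀ i, Convex ℝ (Sset i))
    (f : (i : Fin n) → ((j : Fin n) → Fin (k j) → ℝ) → Fin (k i) → ℝ)
    (hf_mem : ∀ i q, (∀ j, q j ∈ Sset j) → f i q ∈ Sset i)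
    (hf_indep : ∀ i q q', (∀ j, j ≠ i → q j = q' j) → f i q = f i q')
    (qstar : (j : Fin n) → Fin (k j) → ℝ) (hqstarS : ∀ j, qstar j ∈ Sset j)
    (hfix : ∀ i, f i qstar = qstar i)
    (γt : Fin n → Fin n → ℝ → ℝ) (hγ : ∀ i j, i ≠ j → ClassN (γt i j))
    (hbound : ∀ q, (∀ j, q j ∈ Sset j) → ∀ i,
      eNorm (fun m => f i q m - qstar i m) ≤
        maxNe i (fun j => γt i j (eNorm (fun m => q j m - qstar j m))))
    (ω : ℝ) (hω : 1 < ω)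
    (hSG : ∀ p : ℕ, 2 ≤ p → p ≤ n → ∀ ι : Fin p → Fin n, Function.Injective ι →
      ∀ s : ℝ, 0 < s → cyclicComp (fun i j s => ω * γt i j (ω * s)) ι s < s) :
    ∀ q : (j : Fin n) → Fin (k j) → ℝ,
      (∀ j, q j ∈ Sset j) → (∀ i, f i q = q i) → q = qstar := by
  intro q hq hqfix
  set a : Fin n → ℝ := fun i => eNorm (fun m => q i m - qstar i m)
  have ha : ∀ i, 0 ≤ a i := fun i => eNorm_nonneg _
  have hmax : ∀ i, ∃ j, j ≠ i ∧ a i ≤ γt i j (a j) := by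
    intro i
    obtain ⟨j, hj, heq⟩ := exists_ne_maxNe_eq hn i (fun j => γt i j (a j))
    refine ⟨j, hj, heq ▸ ?_⟩
    have h := hbound q hq i
    rwa [hqfix i] at h
  choose σ hσ hle using hmax
  have hzero : ∀ i, a i = 0 := by
    refine eq_zero_of_le_gain _ hSG a ha σ hσ (fun i h => ?_) (fun i t ht => ?_)
    · have h1 := hle i
      rw [h, (hγ i (σ i) (hσ i).symm).2.2.1] at h1
      exact h1.antisymm (ha i)
    · obtain ⟨-, hmono, -, -⟩ := hγ i (σ i) (hσ i).symm
      have ht0 : 0 ≤ t := (ha _).trans ht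
      have htω : a (σ i) ≤ ω * t := ht.trans (le_mul_of_one_le_left ht0 hω.le)
      have h1 : a i ≤ γt i (σ i) (ω * t) :=
        (hle i).trans (hmono (ha _) ((ha _).trans htω) htω)
      exact h1.trans (le_mul_of_one_le_left ((ha i).trans h1) hω.le)
  funext i m
  exact sub_eq_zero.mp (congrFun (eq_zero_of_eNorm_eq_zero (hzero i)) m)
end

section
/- Let n ≥ 2, σ > 0, h > 0, B ≥ 0, let V_i : [0,∞) → [0,∞) (i = 1,…,n) be functions that are bounded on bounded intervals, and let Γ_{i,j} : [0,∞) → [0,∞) (i ≠ j) be non-decreasing functions. Suppose for all t ≥ 0 and all i: V_i(t+h) ≤ max{ e^{−σh}·V_i(t), B·sup_{t≤s≤t+h} V_i(s), max_{j≠i} Γ_{i,j}(sup_{t≤s≤t+h} V_j(s)) }. Then for every t ≥ 0, every non-negative integer k and every i: V_i(t+kh) ≤ max{ e^{−σkh}·V_i(t), B·sup_{t≤s≤t+kh} V_i(s), max_{j≠i} Γ_{i,j}(sup_{t≤s≤t+kh} V_j(s)) }. -/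
theorem le_maxNe {n : ℕ} {i j : Fin n} (hji : j ≠ i) (g : Fin n → ℝ) : g j ≤ maxNe i g :=
  le_csSup ((Set.finite_range g).bddAbove.mono (by rintro _ ⟨j, -, rfl⟩; exact ⟨j, rfl⟩))
    ⟨j, hji, rfl⟩

theorem maxNe_nonneg {n : ℕ} {i : Fin n} {g : Fin n → ℝ} (hg : ∀ j, j ≠ i → 0 ≤ g j) :
    0 ≤ maxNe i g :=
  Real.sSup_nonneg (by rintro _ ⟨j, hj, rfl⟩; exact hg j hj)

theorem maxNe_le_maxNe {n : ℕ} {i : Fin n} {f g : Fin n → ℝ} (hg : ∀ j, j ≠ i → 0 ≤ g j)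
    (hfg : ∀ j, j ≠ i → f j ≤ g j) : maxNe i f ≤ maxNe i g :=
  Real.sSup_le (by rintro _ ⟨j, hj, rfl⟩; exact (hfg j hj).trans (le_maxNe hj g))
    (maxNe_nonneg hg)

/-- The induction step (A.11)/(A.20): iterating the one-step
contraction-plus-gain estimate for the functionals `V_i` over `k` steps of length `h`. -/
theorem iterated_contraction_gain_estimate (n : ℕ) (hn : 2 ≤ n) (σ h B : ℝ)
    (hσ : 0 < σ) (hh : 0 < h) (hB : 0 ≤ B)
    (V : Fin n → ℝ → ℝ)
    (hVpos : ∀ i t, 0 ≤ t → 0 ≤ V i t)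
    (hVbdd : ∀ (i : Fin n) (b : ℝ), ∃ M : ℝ, ∀ t ∈ Set.Icc (0 : ℝ) b, V i t ≤ M)
    (Γ : Fin n → Fin n → ℝ → ℝ)
    (hΓmono : ∀ i j, i ≠ j → MonotoneOn (Γ i j) (Set.Ici 0))
    (hΓpos : ∀ i j, i ≠ j → ∀ s, 0 ≤ s → 0 ≤ Γ i j s)
    (hstep : ∀ t, 0 ≤ t → ∀ i,
      V i (t + h) ≤ max (Real.exp (-σ * h) * V i t)
        (max (B * sSup (V i '' Set.Icc t (t + h)))
          (maxNe i (fun j => Γ i j (sSup (V j '' Set.Icc t (t + h))))))) :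
    ∀ t, 0 ≤ t → ∀ k : ℕ, ∀ i,
      V i (t + k * h) ≤ max (Real.exp (-σ * (k * h)) * V i t)
        (max (B * sSup (V i '' Set.Icc t (t + k * h)))
          (maxNe i (fun j => Γ i j (sSup (V j '' Set.Icc t (t + k * h)))))) := by
  have sup_nonneg : ∀ (j : Fin n) (a b : ℝ), 0 ≤ a → 0 ≤ sSup (V j '' Set.Icc a b) := by
    intro j a b ha
    refine Real.sSup_nonneg ?_
    rintro _ ⟨s, hs, rfl⟩
    exact hVpos j s (ha.trans hs.1)
  have sup_mono : ∀ (j : Fin n) (a b c d : ℝ), 0 ≤ a → a ≤ b → c ≤ d →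
      sSup (V j '' Set.Icc b c) ≤ sSup (V j '' Set.Icc a d) := by
    intro j a b c d ha hab hcd
    refine Real.sSup_le ?_ (sup_nonneg j a d ha)
    rintro _ ⟨s, hs, rfl⟩
    obtain ⟨M, hM⟩ := hVbdd j d
    refine le_csSup ⟨M, ?_⟩ ⟨s, Set.Icc_subset_Icc hab hcd hs, rfl⟩
    rintro _ ⟨r, hr, rfl⟩
    exact hM r ⟨ha.trans hr.1, hr.2⟩
  have gain_nonneg : ∀ (i : Fin n) (a b : ℝ), 0 ≤ a → ∀ j, j ≠ i →
      0 ≤ Γ i j (sSup (V j '' Set.Icc a b)) := fun i a b ha j hj =>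
    hΓpos i j hj.symm _ (sup_nonneg j a b ha)
  have rest_mono : ∀ (i : Fin n) (a b c d : ℝ), 0 ≤ a → a ≤ b → c ≤ d →
      max (B * sSup (V i '' Set.Icc b c))
        (maxNe i (fun j => Γ i j (sSup (V j '' Set.Icc b c)))) ≤
      max (B * sSup (V i '' Set.Icc a d))
        (maxNe i (fun j => Γ i j (sSup (V j '' Set.Icc a d)))) := by
    intro i a b c d ha hab hcd
    refine max_le_max (mul_le_mul_of_nonneg_left (sup_mono i a b c d ha hab hcd) hB)
      (maxNe_le_maxNe (gain_nonneg i a d ha) fun j hj => ?_)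
    exact hΓmono i j hj.symm (sup_nonneg j b c (ha.trans hab)) (sup_nonneg j a d ha)
      (sup_mono j a b c d ha hab hcd)
  intro t ht k i
  induction k with
  | zero => simp
  | succ k ih =>
    have hkh : 0 ≤ (k : ℝ) * h := by positivity
    have htime : t + ((k + 1 : ℕ) : ℝ) * h = t + k * h + h := by push_cast; ring
    have hexp : Real.exp (-σ * (((k + 1 : ℕ) : ℝ) * h)) =
        Real.exp (-σ * h) * Real.exp (-σ * (k * h)) := by
      rw [← Real.exp_add]; congr 1; push_cast; ring
    rw [htime, hexp]
    refine (hstep (t + k * h) (by linarith) i).trans (max_le ?_ ?_)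
    · refine (mul_le_mul_of_nonneg_left ih (Real.exp_pos _).le).trans ?_
      rw [mul_max_of_nonneg _ _ (Real.exp_pos _).le, mul_assoc]
      refine max_le_max le_rfl (le_trans ?_ (rest_mono i t t (t + k * h) _ ht le_rfl (by linarith)))
      refine mul_le_of_le_one_left (le_max_of_le_right (maxNe_nonneg (gain_nonneg i _ _ ht))) ?_
      exact Real.exp_le_one_iff.mpr (by nlinarith)
    · exact le_max_of_le_right (rest_mono i t _ _ _ ht (by linarith) le_rfl)
end
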